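/- arXiv:2302.07383 — 3 statements merged into one kernel-verified Lean document; each statement's English description precedes it below -/
import Mathlib

section
/- Under (A2.1) and (A2.2), with C nonempty and compact, and with M̄ > 0 fixed: for every γ > 2M̄/η the set C^γ(α_γ) := {x : ψ_γ(x) ≤ −α_γ} is compact and is contained in the interior of C^γ, which in turn is contained in C; moreover there exists Γ > 2M̄/η such that for every γ ≥ Γ: (a) the topological boundary of C^γ(α_γ) equals {x : ψ_γ(x) = −α_γ} and is nonempty, and (b) the topological interior of C^γ(α_γ) equals {x : ψ_γ(x) < −α_γ} and is nonempty. -/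
open Metric Set
open scoped BigOperators

noncomputable section

/-- The log-exponential approximation `ψ_γ`. -/
def psiG {n r : ℕ} (ψ : Fin r → EuclideanSpace ℝ (Fin n) → ℝ) (γ : ℝ)
    (x : EuclideanSpace ℝ (Fin n)) : ℝ :=
  (1 / γ) * Real.log (∑ i, Real.exp (γ * ψ i x))

/-- The level `α_γ := ln(ηγ/(2M̄))/γ`. -/
def alph (η Mb γ : ℝ) : ℝ := Real.log (η * γ / (2 * Mb)) / γ

open Filter Topology

section LogSumExp

variable {n r : ℕ} {ψ : Fin r → EuclideanSpace ℝ (Fin n) → ℝ} {γ : ℝ}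
  {x : EuclideanSpace ℝ (Fin n)}

/-- The softmax weights appearing in the gradient of `psiG`. -/
def softmaxWeight (ψ : Fin r → EuclideanSpace ℝ (Fin n) → ℝ) (γ : ℝ)
    (x : EuclideanSpace ℝ (Fin n)) (i : Fin r) : ℝ :=
  Real.exp (γ * ψ i x) / ∑ j, Real.exp (γ * ψ j x)

theorem sum_exp_pos (hr : 0 < r) (ψ : Fin r → EuclideanSpace ℝ (Fin n) → ℝ) (γ : ℝ)
    (x : EuclideanSpace ℝ (Fin n)) : 0 < ∑ i, Real.exp (γ * ψ i x) :=
  Finset.sum_pos (fun _ _ => Real.exp_pos _) ⟨⟨0, hr⟩, Finset.mem_univ _⟩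

theorem exp_mul_psiG (hr : 0 < r) (hγ : 0 < γ) :
    Real.exp (γ * psiG ψ γ x) = ∑ i, Real.exp (γ * ψ i x) := by
  have h : γ * psiG ψ γ x = Real.log (∑ i, Real.exp (γ * ψ i x)) := by
    unfold psiG
    field_simp
  rw [h, Real.exp_log (sum_exp_pos hr ψ γ x)]

theorem le_psiG (hr : 0 < r) (hγ : 0 < γ) (i : Fin r) : ψ i x ≤ psiG ψ γ x := by
  have h : Real.exp (γ * ψ i x) ≤ Real.exp (γ * psiG ψ γ x) := by
    rw [exp_mul_psiG hr hγ]
    exact Finset.single_le_sum (f := fun i => Real.exp (γ * ψ i x))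
      (fun _ _ => (Real.exp_pos _).le) (Finset.mem_univ i)
  exact le_of_mul_le_mul_left (Real.exp_le_exp.1 h) hγ

theorem psiG_le (hr : 0 < r) (hγ : 0 < γ) {m : ℝ} (hm : ∀ i, ψ i x ≤ m) :
    psiG ψ γ x ≤ m + Real.log r / γ := by
  have hr' : (0 : ℝ) < r := by exact_mod_cast hr
  have h : ∑ i, Real.exp (γ * ψ i x) ≤ r * Real.exp (γ * m) := by
    calc ∑ i, Real.exp (γ * ψ i x) ≤ ∑ _i : Fin r, Real.exp (γ * m) := by
          gcongr with i
          exact hm i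
      _ = r * Real.exp (γ * m) := by simp
  have h2 := Real.log_le_log (sum_exp_pos hr ψ γ x) h
  rw [Real.log_mul hr'.ne' (Real.exp_pos _).ne', Real.log_exp] at h2
  calc psiG ψ γ x ≤ 1 / γ * (Real.log r + γ * m) := by
        unfold psiG
        gcongr
    _ = m + Real.log r / γ := by
        field_simp
        ring

theorem softmaxWeight_mem_stdSimplex (hr : 0 < r) :
    softmaxWeight ψ γ x ∈ stdSimplex ℝ (Fin r) := by
  refine ⟨fun i => div_nonneg (Real.exp_pos _).le (sum_exp_pos hr ψ γ x).le, ?_⟩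
  simp only [softmaxWeight]
  rw [← Finset.sum_div, div_self (sum_exp_pos hr ψ γ x).ne']

theorem softmaxWeight_eq_exp (hr : 0 < r) (hγ : 0 < γ) (i : Fin r) :
    softmaxWeight ψ γ x i = Real.exp (γ * (ψ i x - psiG ψ γ x)) := by
  rw [softmaxWeight, ← exp_mul_psiG hr hγ, ← Real.exp_sub, mul_sub]

theorem hasGradientAt_psiG {g : Fin r → EuclideanSpace ℝ (Fin n)} (hr : 0 < r) (hγ : 0 < γ)
    (h : ∀ i, HasGradientAt (ψ i) (g i) x) :
    HasGradientAt (psiG ψ γ) (∑ i, softmaxWeight ψ γ x i • g i) x := by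
  have hsum : HasFDerivAt (fun y => ∑ i, Real.exp (γ * ψ i y))
      (∑ i, Real.exp (γ * ψ i x) • γ • InnerProductSpace.toDual ℝ _ (g i)) x :=
    HasFDerivAt.fun_sum fun i _ => ((h i).hasFDerivAt.const_mul γ).exp
  have hlog := (hsum.log (sum_exp_pos hr ψ γ x).ne').const_mul (1 / γ)
  rw [hasGradientAt_iff_hasFDerivAt]
  refine HasFDerivAt.congr_fderiv (f := psiG ψ γ) hlog ?_
  simp only [map_sum, map_smulₛₗ, conj_trivial, Finset.smul_sum, smul_smul, softmaxWeight]
  refine Finset.sum_congr rfl fun i _ => ?_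
  congr 1
  field_simp

theorem continuousAt_psiG (hr : 0 < r) (h : ∀ i, ContinuousAt (ψ i) x) :
    ContinuousAt (psiG ψ γ) x := by
  refine ContinuousAt.mul continuousAt_const (ContinuousAt.log ?_ (sum_exp_pos hr ψ γ x).ne')
  exact tendsto_finsetSum _ fun i _ => ((h i).const_mul γ).rexp

theorem sum_softmaxWeight_smul_eq_zero {g : Fin r → EuclideanSpace ℝ (Fin n)}
    (hr : 0 < r) (hγ : 0 < γ) (h : ∀ i, HasGradientAt (ψ i) (g i) x)
    (hx : IsLocalExtr (psiG ψ γ) x) : ∑ i, softmaxWeight ψ γ x i • g i = 0 := by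
  have h0 := hx.hasFDerivAt_eq_zero (hasGradientAt_psiG hr hγ h).hasFDerivAt
  exact (map_eq_zero_iff _ (InnerProductSpace.toDual ℝ _).injective).1 h0

/-- If critical points of `psiG ψ (γ k)`, at levels tending to zero as `γ k → ∞`, converge to `c`,
then `c` is feasible and a convex combination of the active gradients at `c` vanishes. -/
theorem exists_multiplier_of_tendsto (hr : 0 < r)
    {ψ' : Fin r → EuclideanSpace ℝ (Fin n) → EuclideanSpace ℝ (Fin n)}
    {γ : ℕ → ℝ} {x : ℕ → EuclideanSpace ℝ (Fin n)} {c : EuclideanSpace ℝ (Fin n)}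
    (hγ : Tendsto γ atTop atTop) (hx : Tendsto x atTop (𝓝 c))
    (hψ : ∀ i, ContinuousAt (ψ i) c) (hψ' : ∀ i, ContinuousAt (ψ' i) c)
    (hlev : Tendsto (fun k => psiG ψ (γ k) (x k)) atTop (𝓝 0))
    (hcrit : ∀ᶠ k in atTop, ∑ i, softmaxWeight ψ (γ k) (x k) i • ψ' i (x k) = 0) :
    (∀ i, ψ i c ≤ 0) ∧ ∃ lam : Fin r → ℝ, (∀ i, 0 ≤ lam i) ∧
      (∀ i, ψ i c ≠ 0 → lam i = 0) ∧ ∑ i, lam i = 1 ∧ ∑ i, lam i • ψ' i c = 0 := by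
  have hle : ∀ i, ψ i c ≤ 0 := fun i =>
    le_of_tendsto_of_tendsto ((hψ i).tendsto.comp hx) hlev <| by
      filter_upwards [hγ.eventually_gt_atTop 0] with k hk using le_psiG hr hk i
  obtain ⟨lam, hlam, φ, hφ, hlim⟩ := (isCompact_stdSimplex ℝ (Fin r)).tendsto_subseq
    fun k => softmaxWeight_mem_stdSimplex (ψ := ψ) (γ := γ k) (x := x k) hr
  have hlim' := tendsto_pi_nhds.1 hlim
  refine ⟨hle, lam, hlam.1, fun i hi => ?_, hlam.2, ?_⟩
  · have hneg : ψ i c - 0 < 0 := by simpa using lt_of_le_of_ne (hle i) hi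
    have h1 : Tendsto (fun k => softmaxWeight ψ (γ k) (x k) i) atTop (𝓝 0) := by
      have h2 := Real.tendsto_exp_atBot.comp
        (hγ.atTop_mul_neg hneg (((hψ i).tendsto.comp hx).sub hlev))
      refine h2.congr' ?_
      filter_upwards [hγ.eventually_gt_atTop 0] with k hk
      simp [softmaxWeight_eq_exp hr hk]
    exact tendsto_nhds_unique (hlim' i) (h1.comp hφ.tendsto_atTop)
  · have h1 : Tendsto (fun k => ∑ i, softmaxWeight ψ (γ (φ k)) (x (φ k)) i • ψ' i (x (φ k)))
        atTop (𝓝 (∑ i, lam i • ψ' i c)) :=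
      tendsto_finsetSum _ fun i _ =>
        (hlim' i).smul (((hψ' i).tendsto.comp hx).comp hφ.tendsto_atTop)
    refine tendsto_nhds_unique h1 (tendsto_const_nhds.congr' ?_)
    filter_upwards [hφ.tendsto_atTop.eventually hcrit] with k hk using hk.symm

end LogSumExp

theorem tendsto_alph {η Mb : ℝ} (hη : 0 < η) (hMb : 0 < Mb) :
    Tendsto (alph η Mb) atTop (𝓝 0) := by
  have h1 : Tendsto (fun γ : ℝ => Real.log (η / (2 * Mb)) / γ + Real.log γ / γ) atTop
      (𝓝 (0 + 0)) :=
    (tendsto_const_nhds.div_atTop tendsto_id).add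
      Real.isLittleO_log_id_atTop.tendsto_div_nhds_zero
  rw [add_zero] at h1
  refine h1.congr' ?_
  filter_upwards [eventually_gt_atTop 0] with γ hγ
  rw [alph, ← add_div, ← Real.log_mul (by positivity) hγ.ne']
  congr 2
  ring

theorem alph_pos {η Mb γ : ℝ} (hη : 0 < η) (hMb : 0 < Mb) (hγ : 2 * Mb / η < γ) :
    0 < alph η Mb γ := by
  have hγ0 : 0 < γ := lt_trans (by positivity) hγ
  refine div_pos (Real.log_pos ?_) hγ0
  rw [lt_div_iff₀ (by positivity), one_mul, mul_comm η]
  exact (div_lt_iff₀ hη).1 hγ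

theorem stmt_4 {n r : ℕ} (hn : 0 < n) (hr : 0 < r)
    (ψ : Fin r → EuclideanSpace ℝ (Fin n) → ℝ)
    (ψ' : Fin r → EuclideanSpace ℝ (Fin n) → EuclideanSpace ℝ (Fin n))
    (C : Set (EuclideanSpace ℝ (Fin n)))
    (hCdef : C = ⋂ i, {x | ψ i x ≤ 0})
    (hCne : C.Nonempty) (hCcp : IsCompact C)
    -- (A2.1)
    (ρ : ℝ) (hρ : 0 < ρ)
    (hdiff : ∀ i, ∀ x ∈ {y | ∃ c ∈ C, dist y c < ρ}, HasGradientAt (ψ i) (ψ' i x) x)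
    (hlip : ∀ i, ∃ L : NNReal, LipschitzOnWith L (ψ' i) {y | ∃ c ∈ C, dist y c < ρ})
    -- (A2.2)
    (η : ℝ) (hη : 0 < η)
    (hA22 : ∀ c ∈ C, ∀ lam : Fin r → ℝ, (∀ i, 0 ≤ lam i) →
      (∀ i, ψ i c ≠ 0 → lam i = 0) → (∑ i, lam i) = 1 →
      2 * η < ‖∑ i, lam i • ψ' i c‖)
    (Mb : ℝ) (hMb : 0 < Mb) :
    (∀ γ : ℝ, 2 * Mb / η < γ →
      IsCompact {x : EuclideanSpace ℝ (Fin n) | psiG ψ γ x ≤ -(alph η Mb γ)} ∧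
      {x : EuclideanSpace ℝ (Fin n) | psiG ψ γ x ≤ -(alph η Mb γ)} ⊆
        interior {x : EuclideanSpace ℝ (Fin n) | psiG ψ γ x ≤ 0} ∧
      {x : EuclideanSpace ℝ (Fin n) | psiG ψ γ x ≤ 0} ⊆ C) ∧
    (∃ Γ : ℝ, 2 * Mb / η < Γ ∧ ∀ γ ≥ Γ,
      (frontier {x : EuclideanSpace ℝ (Fin n) | psiG ψ γ x ≤ -(alph η Mb γ)} =
        {x : EuclideanSpace ℝ (Fin n) | psiG ψ γ x = -(alph η Mb γ)} ∧
        {x : EuclideanSpace ℝ (Fin n) | psiG ψ γ x = -(alph η Mb γ)}.Nonempty) ∧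
      (interior {x : EuclideanSpace ℝ (Fin n) | psiG ψ γ x ≤ -(alph η Mb γ)} =
        {x : EuclideanSpace ℝ (Fin n) | psiG ψ γ x < -(alph η Mb γ)} ∧
        {x : EuclideanSpace ℝ (Fin n) | psiG ψ γ x < -(alph η Mb γ)}.Nonempty)) := by
  set U : Set (EuclideanSpace ℝ (Fin n)) := {y | ∃ c ∈ C, dist y c < ρ} with hU
  have hUeq : U = thickening ρ C := by
    ext y
    simp [hU, mem_thickening_iff]
  have hUo : IsOpen U := hUeq ▸ isOpen_thickening
  have hCU : C ⊆ U := hUeq ▸ self_subset_thickening hρ C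
  have hψc : ∀ x ∈ U, ∀ i, ContinuousAt (ψ i) x := fun x hx i =>
    (hdiff i x hx).hasFDerivAt.continuousAt
  have hψ'c : ∀ x ∈ U, ∀ i, ContinuousAt (ψ' i) x := fun x hx i =>
    (hlip i).choose_spec.continuousOn.continuousAt (hUo.mem_nhds hx)
  have hmem : ∀ x, (∀ i, ψ i x ≤ 0) → x ∈ C := fun x hx => by
    rw [hCdef]
    exact mem_iInter.2 hx
  have hCle : ∀ x ∈ C, ∀ i, ψ i x ≤ 0 := fun x hx i => by
    rw [hCdef] at hx
    exact mem_iInter.1 hx i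
  have hγ0 : ∀ γ, 2 * Mb / η < γ → 0 < γ := fun γ hγ => lt_trans (by positivity) hγ
  have hsub : ∀ γ, 0 < γ → ∀ x, psiG ψ γ x ≤ 0 → x ∈ C := fun γ hγ x hx =>
    hmem x fun i => (le_psiG hr hγ i).trans hx
  have hsub' : ∀ γ, 2 * Mb / η < γ → ∀ x, psiG ψ γ x ≤ -(alph η Mb γ) → x ∈ C :=
    fun γ hγ x hx => hsub γ (hγ0 γ hγ) x (by linarith [alph_pos hη hMb hγ])
  have hlt : ∀ γ a, ∀ x ∈ U, psiG ψ γ x < a → {y | psiG ψ γ y < a} ∈ 𝓝 x :=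
    fun γ a x hx h => (continuousAt_psiG hr (hψc x hx)).eventually_lt_const h
  have hcpt : ∀ γ, 2 * Mb / η < γ → IsCompact {x | psiG ψ γ x ≤ -(alph η Mb γ)} := by
    intro γ hγ
    have hcont : ContinuousOn (psiG ψ γ) C := fun x hx =>
      (continuousAt_psiG hr (hψc x (hCU hx))).continuousWithinAt
    have hcl := hcont.preimage_isClosed_of_isClosed hCcp.isClosed
      (isClosed_Iic (a := -(alph η Mb γ)))
    refine hCcp.of_isClosed_subset ?_ (hsub' γ hγ)
    convert hcl using 1
    ext x
    exact ⟨fun h => ⟨hsub' γ hγ x h, h⟩, fun h => h.2⟩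
  have hnocrit : ∀ (g : ℕ → ℝ) (x : ℕ → EuclideanSpace ℝ (Fin n)) (c : EuclideanSpace ℝ (Fin n)),
      Tendsto g atTop atTop → Tendsto x atTop (𝓝 c) → c ∈ U →
      Tendsto (fun k => psiG ψ (g k) (x k)) atTop (𝓝 0) →
      ¬ ∀ᶠ k in atTop, IsLocalExtr (psiG ψ (g k)) (x k) := by
    intro g x c hg hx hc hlev hext
    obtain ⟨hle, lam, h0, h1, h2, h3⟩ := exists_multiplier_of_tendsto hr hg hx (hψc c hc)
      (hψ'c c hc) hlev <| by
        filter_upwards [hext, hg.eventually_gt_atTop 0, hx.eventually (hUo.mem_nhds hc)]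
          with k hk hgk hxk
        exact sum_softmaxWeight_smul_eq_zero hr hgk (fun i => hdiff i _ hxk) hk
    have h4 := hA22 c (hmem c hle) lam h0 h1 h2
    rw [h3, norm_zero] at h4
    linarith
  have hlogr : Tendsto (fun γ : ℝ => Real.log r / γ) atTop (𝓝 0) :=
    tendsto_const_nhds.div_atTop tendsto_id
  have hslater : ∃ x, ∀ i, ψ i x < 0 := by
    by_contra! hns
    obtain ⟨c₀, hc₀⟩ := hCne
    set K := cthickening (ρ / 2) C
    have hKU : K ⊆ U := hUeq ▸ cthickening_subset_thickening' hρ (by linarith) C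
    have hKc : IsCompact K := hCcp.cthickening
    have hCK : C ⊆ K := self_subset_cthickening C
    have hmin : ∀ k : ℕ, ∃ x ∈ K, IsMinOn (psiG ψ (k : ℝ)) K x := fun k =>
      hKc.exists_isMinOn ⟨c₀, hCK hc₀⟩ fun x hx =>
        (continuousAt_psiG hr (hψc x (hKU hx))).continuousWithinAt
    choose x hxK hxmin using hmin
    obtain ⟨c, hcK, φ, hφ, hlim⟩ := hKc.tendsto_subseq hxK
    have hg : Tendsto (fun k => ((φ k : ℕ) : ℝ)) atTop atTop :=
      tendsto_natCast_atTop_atTop.comp hφ.tendsto_atTop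
    have hlev : Tendsto (fun k => psiG ψ (φ k : ℝ) (x (φ k))) atTop (𝓝 0) := by
      refine tendsto_of_tendsto_of_tendsto_of_le_of_le' tendsto_const_nhds (hlogr.comp hg) ?_ ?_
      · filter_upwards [hg.eventually_gt_atTop 0] with k hk
        obtain ⟨i, hi⟩ := hns (x (φ k))
        exact hi.trans (le_psiG hr hk i)
      · filter_upwards [hg.eventually_gt_atTop 0] with k hk
        refine (hxmin (φ k) (hCK hc₀)).trans ?_
        simpa using psiG_le hr hk (hCle c₀ hc₀)
    have hcC : c ∈ C := hmem c fun i =>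
      le_of_tendsto_of_tendsto ((hψc c (hKU hcK) i).tendsto.comp hlim) hlev <| by
        filter_upwards [hg.eventually_gt_atTop 0] with k hk using le_psiG hr hk i
    have hKn : ∀ᶠ y in 𝓝 c, K ∈ 𝓝 y :=
      eventually_mem_nhds_iff.2 <| mem_of_superset
        (isOpen_thickening.mem_nhds (self_subset_thickening (half_pos hρ) C hcC))
        (thickening_subset_cthickening _ C)
    refine hnocrit _ _ c hg hlim (hKU hcK) hlev ?_
    filter_upwards [hlim.eventually hKn] with k hk
    exact Or.inl ((hxmin (φ k)).isLocalMin hk)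
  have hnomax : ∀ᶠ γ in atTop, ∀ x, psiG ψ γ x = -(alph η Mb γ) →
      ¬ IsLocalMax (psiG ψ γ) x := by
    by_contra hcon
    obtain ⟨g, hg, hbad⟩ := exists_seq_forall_of_frequently
      ((not_eventually.1 hcon).and_eventually (eventually_gt_atTop (2 * Mb / η)))
    have hbad' : ∀ k, ∃ x, psiG ψ (g k) x = -(alph η Mb (g k)) ∧
        IsLocalMax (psiG ψ (g k)) x := fun k => by
      have h := (hbad k).1
      push Not at h
      exact h
    choose x hxl hxm using hbad'
    obtain ⟨c, hc, φ, hφ, hlim⟩ := hCcp.tendsto_subseq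
      fun k => hsub' (g k) (hbad k).2 (x k) (hxl k).le
    have hg' := hg.comp hφ.tendsto_atTop
    refine hnocrit _ _ c hg' hlim (hCU hc) ?_ (Eventually.of_forall fun k => Or.inr (hxm (φ k)))
    have h1 := ((tendsto_alph hη hMb).comp hg').neg
    rw [neg_zero] at h1
    exact h1.congr fun k => (hxl (φ k)).symm
  refine ⟨fun γ hγ => ⟨hcpt γ hγ, fun x hx => ?_, hsub γ (hγ0 γ hγ)⟩, ?_⟩
  · have hx' : psiG ψ γ x < 0 := lt_of_le_of_lt hx (by linarith [alph_pos hη hMb hγ])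
    exact mem_interior_iff_mem_nhds.2 <| mem_of_superset
      (hlt γ 0 x (hCU (hsub' γ hγ x hx)) hx') fun y (hy : psiG ψ γ y < 0) => hy.le
  obtain ⟨x₀, hx₀⟩ := hslater
  have hne : ∀ᶠ γ in atTop, psiG ψ γ x₀ < -(alph η Mb γ) := by
    have : Nonempty (Fin r) := ⟨⟨0, hr⟩⟩
    obtain ⟨j, hj⟩ := Finite.exists_max fun i => ψ i x₀
    have h1 : Tendsto (fun γ => ψ j x₀ + Real.log r / γ + alph η Mb γ) atTop
        (𝓝 (ψ j x₀ + 0 + 0)) := (hlogr.const_add _).add (tendsto_alph hη hMb)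
    have h2 : ψ j x₀ + 0 + 0 < 0 := by simpa using hx₀ j
    filter_upwards [h1.eventually_lt_const h2, eventually_gt_atTop 0] with γ hγ hγpos
    have := psiG_le hr hγpos hj
    linarith
  obtain ⟨Γ, hΓ⟩ := eventually_atTop.1
    ((hnomax.and hne).and (eventually_gt_atTop (2 * Mb / η)))
  refine ⟨Γ, (hΓ Γ le_rfl).2, fun γ hγ => ?_⟩
  obtain ⟨⟨hmax, hγne⟩, hγgt⟩ := hΓ γ hγ
  have hint : interior {x | psiG ψ γ x ≤ -(alph η Mb γ)} =
      {x | psiG ψ γ x < -(alph η Mb γ)} := by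
    ext x
    rw [mem_interior_iff_mem_nhds]
    refine ⟨fun hx => lt_of_le_of_ne (mem_of_mem_nhds hx :) fun heq => hmax x heq ?_, fun hx => ?_⟩
    · filter_upwards [hx] with y hy
      exact heq ▸ hy
    · exact mem_of_superset
        (hlt γ _ x (hCU (hsub' γ hγgt x (le_of_lt hx))) hx) fun y (hy : psiG ψ γ y < _) => hy.le
  have hfr : frontier {x | psiG ψ γ x ≤ -(alph η Mb γ)} =
      {x | psiG ψ γ x = -(alph η Mb γ)} := by
    rw [(hcpt γ hγgt).isClosed.frontier_eq, hint]
    ext x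
    simp only [Set.mem_sdiff, mem_ofPred_eq, not_lt]
    exact ⟨fun h => le_antisymm h.1 h.2, fun h => ⟨h.le, h.ge⟩⟩
  refine ⟨⟨hfr, ?_⟩, hint, x₀, hγne⟩
  rw [← hfr, nonempty_frontier_iff]
  have : Nonempty (Fin n) := ⟨⟨0, hn⟩⟩
  have : NoncompactSpace (EuclideanSpace ℝ (Fin n)) := NormedSpace.noncompactSpace ℝ _
  exact ⟨⟨x₀, hγne.le⟩, (hcpt γ hγgt).ne_univ⟩
end
end

section
/- (Extra properties when the solution starts in C^γ(α_γ).) Let T > 0, U : [0,T] ⇉ ℝᵐ, and u : [0,T] → ℝᵐ measurable with u(t) ∈ U(t) a.e. Let f_Φ : [0,T] × ℝⁿ × ℝᵐ → ℝⁿ satisfy: for each fixed (x,v) with x ∈ C, t ↦ f_Φ(t,x,v) is Lebesgue measurable; and there is M̄ > 0 such that for a.e. t, (x,v) ↦ f_Φ(t,x,v) is continuous on C × U(t), x ↦ f_Φ(t,x,v) is M̄-Lipschitz on C for each v ∈ U(t), and ‖f_Φ(t,x,v)‖ ≤ M̄ on C × U(t). Assume (A2.1), (A2.2), and C nonempty compact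 with connected interior. Then there exists Γ > 2M̄/η such that for every γ ≥ Γ and every c ∈ C^γ(α_γ), every absolutely continuous x : [0,T] → ℝⁿ satisfying x(t) = c + ∫₀ᵗ [ f_Φ(s, x(s), u(s)) − Σ_{i=1}^r γ e^{γ ψ_i(x(s))} ∇ψ_i(x(s)) ] ds for all t ∈ [0,T] satisfies: (i) x(t) ∈ C^γ(α_γ) ⊆ int C^γ ⊆ int C for all t ∈ [0,T]; (ii) 0 ≤ γ e^{γ ψ_i(x(t))} ≤ Σ_{j=1}^r γ e^{γ ψ_j(x(t))} ≤ 2M̄/η for all t ∈ [0,T] and all i; and (iii) ‖x'(t)‖ ≤ M̄ + 2M̄M̄_ψ/η for a.e. t ∈ [0,T]. -/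
open Metric Set Filter MeasureTheory
open scoped BigOperators

noncomputable section

open Topology in
/-- A trajectory driven by `h - ∇S` strictly decreases `S` just after a time at which `∇S`
dominates the bound on `h`. -/
lemma eventually_lt_of_integral_sub_gradient {E : Type*} [NormedAddCommGroup E]
    [InnerProductSpace ℝ E] [CompleteSpace E] {S : E → ℝ} {G : E → E} {x h : ℝ → E} {a b M : ℝ}
    (hab : a < b) (hM : 0 ≤ M) (hS : HasGradientAt S (G (x a)) (x a))
    (hG : ContinuousAt G (x a)) (hx : ContinuousWithinAt x (Ioi a) a) (hMG : M < ‖G (x a)‖)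
    (hint : IntervalIntegrable (fun s => h s - G (x s)) volume a b)
    (heq : ∀ t ∈ Icc a b, x t - x a = ∫ s in a..t, (h s - G (x s)))
    (hbd : ∀ᵐ s, s ∈ Ioc a b → ‖h s‖ ≤ M) :
    ∀ᶠ t in 𝓝[>] a, S (x t) < S (x a) := by
  set g := G (x a) with hg
  have hgpos : 0 < ‖g‖ := hM.trans_lt hMG
  set d := ‖g‖ - M with hd
  have hdpos : 0 < d := sub_pos.2 hMG
  have hGx : Tendsto (fun s => G (x s)) (𝓝[>] a) (𝓝 g) := hG.tendsto.comp hx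
  have hnear : ∀ᶠ s in 𝓝[>] a, dist (G (x s)) g < d / 2 :=
    (Metric.tendsto_nhds.1 hGx) _ (half_pos hdpos)
  obtain ⟨e, hae, he⟩ := mem_nhdsGT_iff_exists_Ioc_subset.1 hnear
  have hlin : ∀ᶠ t in 𝓝[>] a, ‖S (x t) - S (x a) - inner ℝ g (x t - x a)‖
      ≤ d / 8 * ‖x t - x a‖ := by
    have := (hasGradientAt_iff_isLittleO.1 hS).def (show 0 < d / 8 by positivity)
    exact hx.eventually this
  filter_upwards [hlin, Ioc_mem_nhdsGT hae, Ioc_mem_nhdsGT hab] with t ht hte htb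
  have hat : a < t := hte.1
  have hgood : ∀ᵐ s, s ∈ Ioc a t → ‖h s‖ ≤ M ∧ ‖G (x s) - g‖ ≤ d / 2 := by
    filter_upwards [hbd] with s hs hst
    refine ⟨hs ⟨hst.1, hst.2.trans htb.2⟩, ?_⟩
    have := he ⟨hst.1, hst.2.trans hte.2⟩
    rw [mem_ofPred_eq, dist_eq_norm] at this
    exact this.le
  have hint' : IntervalIntegrable (fun s => h s - G (x s)) volume a t :=
    hint.mono_set (by
      rw [uIcc_of_le hat.le, uIcc_of_le hab.le]; exact Icc_subset_Icc_right htb.2)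
  have hxt := heq t ⟨hat.le, htb.2⟩
  have hnorm : ‖x t - x a‖ ≤ 2 * ‖g‖ * (t - a) := by
    rw [hxt]
    have := intervalIntegral.norm_integral_le_of_norm_le_const_ae (a := a) (b := t)
      (f := fun s => h s - G (x s)) (C := 2 * ‖g‖) (by
        rw [uIoc_of_le hat.le]
        filter_upwards [hgood] with s hs hst
        obtain ⟨h1, h2⟩ := hs hst
        have h3 : ‖G (x s)‖ ≤ ‖g‖ + ‖G (x s) - g‖ := norm_le_insert' _ _
        have h4 := norm_sub_le (h s) (G (x s))
        linarith)
    rwa [abs_of_pos (sub_pos.2 hat)] at this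
  have hinner : inner ℝ g (x t - x a) ≤ -(‖g‖ * d / 2) * (t - a) := by
    rw [hxt, ← innerSL_apply_apply ℝ, ← (innerSL ℝ g).intervalIntegral_comp_comm hint']
    have hle : ∫ s in a..t, innerSL ℝ g (h s - G (x s)) ≤ ∫ _ in a..t, -(‖g‖ * d / 2) := by
      rw [intervalIntegral.integral_of_le hat.le, intervalIntegral.integral_of_le hat.le]
      refine integral_mono_ae ((innerSL ℝ g).integrable_comp hint'.1) (by simp) ?_
      refine (ae_restrict_iff' measurableSet_Ioc).2 ?_
      filter_upwards [hgood] with s hs hst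
      obtain ⟨hhs, hGs⟩ := hs hst
      have hsplit : h s - G (x s) = h s - (G (x s) - g) - g := by abel
      rw [innerSL_apply_apply, hsplit, inner_sub_right, inner_sub_right,
        real_inner_self_eq_norm_sq]
      have h1 := (real_inner_le_norm g (h s)).trans
        (mul_le_mul_of_nonneg_left hhs hgpos.le)
      have h2 := (neg_le_of_abs_le (abs_real_inner_le_norm g (G (x s) - g)))
      have h3 := mul_le_mul_of_nonneg_left hGs hgpos.le
      nlinarith
    refine hle.trans (le_of_eq ?_)
    rw [intervalIntegral.integral_const, smul_eq_mul, mul_comm]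
  have hlin' := (le_abs_self _).trans ht
  have hpos : 0 < ‖g‖ * d * (t - a) := by have := sub_pos.2 hat; positivity
  have := mul_le_mul_of_nonneg_left hnorm (by positivity : (0 : ℝ) ≤ d / 8)
  nlinarith

/-- Gradients of softmax weights: where the total weight is `K`, the weighted gradient is bounded
below once the smoothing parameter is large. -/
lemma exists_forall_lt_norm_sum_exp_smul {E ι : Type*} [NormedAddCommGroup E] [NormedSpace ℝ E]
    [Fintype ι] {f : ι → E → ℝ} {f' : ι → E → E} {C : Set E} {η K : ℝ} (hC : IsCompact C)
    (hf : ∀ i, ContinuousOn (f i) C) (hf' : ∀ i, ContinuousOn (f' i) C)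
    (hle : ∀ i, ∀ y ∈ C, f i y ≤ 0) (hK : 0 < K)
    (hη : ∀ c ∈ C, ∀ w : ι → ℝ, (∀ i, 0 ≤ w i) → (∀ i, f i c ≠ 0 → w i = 0) → ∑ i, w i = 1 →
      η < ‖∑ i, w i • f' i c‖) :
    ∃ Γ : ℝ, ∀ γ ≥ Γ, ∀ y ∈ C, ∑ i, γ * Real.exp (γ * f i y) = K →
      η * K < ‖∑ i, (γ * Real.exp (γ * f i y)) • f' i y‖ := by
  by_contra! hcon
  choose γ hγ y hy hsum hnorm using fun k : ℕ => hcon ((k : ℝ) + 1)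
  have hγpos : ∀ k, 0 < γ k := fun k => (Nat.cast_add_one_pos k).trans_le (hγ k)
  set w : ℕ → ι → ℝ := fun k i => γ k * Real.exp (γ k * f i (y k)) / K with hw
  have hw0 : ∀ k i, 0 ≤ w k i := fun k i => by have := hγpos k; positivity
  have hw1 : ∀ k, ∑ i, w k i = 1 := fun k => by
    rw [← Finset.sum_div, hsum, div_self hK.ne']
  obtain ⟨⟨c, v⟩, ⟨hc, hv⟩, φ, hφ, hlim⟩ :=
    (hC.prod (isCompact_stdSimplex ℝ ι)).tendsto_subseq (x := fun k => (y k, w k))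
      (fun k => ⟨hy k, hw0 k, hw1 k⟩)
  have hyc : Tendsto (fun k => y (φ k)) atTop (nhds c) := (continuous_fst.tendsto _).comp hlim
  have hwv : ∀ i, Tendsto (fun k => w (φ k) i) atTop (nhds (v i)) := fun i =>
    (((continuous_apply i).comp continuous_snd).tendsto (c, v)).comp hlim
  have hycC : Tendsto (fun k => y (φ k)) atTop (nhdsWithin c C) :=
    tendsto_nhdsWithin_iff.2 ⟨hyc, Eventually.of_forall fun k => hy _⟩
  have hγtop : Tendsto (fun k => γ (φ k)) atTop atTop :=
    (tendsto_atTop_mono (fun k => (le_add_of_nonneg_right zero_le_one).trans (hγ k))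
      tendsto_natCast_atTop_atTop).comp hφ.tendsto_atTop
  refine (hη c hc v hv.1 (fun i hi => ?_) hv.2).not_ge ?_
  · have hneg : f i c < 0 := lt_of_le_of_ne (hle i c hc) hi
    obtain ⟨δ, hδ1, hδ2⟩ := exists_between hneg
    have hfy : ∀ᶠ k in atTop, f i (y (φ k)) < δ :=
      ((hf i c hc).tendsto.comp hycC).eventually_lt_const hδ1
    have hzero : Tendsto (fun k => γ (φ k) * Real.exp (γ (φ k) * δ) / K) atTop (nhds 0) := by
      have := (tendsto_rpow_mul_exp_neg_mul_atTop_nhds_zero 1 (-δ) (neg_pos.2 hδ2)).comp hγtop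
      simpa [mul_comm δ] using this.div_const K
    refine tendsto_nhds_unique (hwv i) (squeeze_zero' (Eventually.of_forall fun k => hw0 _ i) ?_
      hzero)
    filter_upwards [hfy] with k hk
    have := hγpos (φ k)
    simp only [hw]
    gcongr
  · have hlim' : Tendsto (fun k => ‖∑ i, w (φ k) i • f' i (y (φ k))‖) atTop
        (nhds ‖∑ i, v i • f' i c‖) :=
      (tendsto_finsetSum _ fun i _ =>
        (hwv i).smul ((hf' i c hc).tendsto.comp hycC)).norm
    refine le_of_tendsto hlim' (Eventually.of_forall fun k => ?_)
    have hk : ∑ i, w (φ k) i • f' i (y (φ k)) = K⁻¹ •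
        ∑ i, (γ (φ k) * Real.exp (γ (φ k) * f i (y (φ k)))) • f' i (y (φ k)) := by
      rw [Finset.smul_sum]
      exact Finset.sum_congr rfl fun i _ => by rw [smul_smul]; simp only [hw, div_eq_inv_mul]
    rw [hk, norm_smul, Real.norm_of_nonneg (inv_nonneg.2 hK.le), inv_mul_le_iff₀ hK, mul_comm K]
    exact hnorm (φ k)

lemma hasGradientAt_sum_exp {E ι : Type*} [NormedAddCommGroup E] [InnerProductSpace ℝ E]
    [CompleteSpace E] [Fintype ι] {f : ι → E → ℝ} {f' : ι → E} {x : E} (γ : ℝ)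
    (hf : ∀ i, HasGradientAt (f i) (f' i) x) :
    HasGradientAt (fun y => ∑ i, Real.exp (γ * f i y))
      (∑ i, (γ * Real.exp (γ * f i x)) • f' i) x := by
  rw [hasGradientAt_iff_hasFDerivAt, map_sum]
  refine HasFDerivAt.fun_sum fun i _ => ?_
  have := ((hf i).hasFDerivAt.const_mul γ).exp
  rwa [smul_smul, mul_comm _ γ, ← map_smul] at this

lemma psiG_le_neg_alph_iff {n r : ℕ} (hr : 0 < r) (ψ : Fin r → EuclideanSpace ℝ (Fin n) → ℝ)
    {η Mb γ : ℝ} (hη : 0 < η) (hMb : 0 < Mb) (hγ : 0 < γ) (y : EuclideanSpace ℝ (Fin n)) :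
    psiG ψ γ y ≤ -(alph η Mb γ) ↔ ∑ i, γ * Real.exp (γ * ψ i y) ≤ 2 * Mb / η := by
  have : Nonempty (Fin r) := ⟨⟨0, hr⟩⟩
  have hS : 0 < ∑ i, Real.exp (γ * ψ i y) :=
    Finset.sum_pos (fun _ _ => Real.exp_pos _) Finset.univ_nonempty
  rw [psiG, alph, one_div_mul_eq_div, ← neg_div, div_le_div_iff_of_pos_right hγ, ← Real.log_inv,
    Real.log_le_log_iff hS (by positivity), inv_div, ← Finset.mul_sum, mul_comm η γ, ← div_div,
    div_right_comm, le_div_iff₀ hγ, mul_comm γ]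

lemma nonpos_of_psiG_nonpos {n r : ℕ} {ψ : Fin r → EuclideanSpace ℝ (Fin n) → ℝ} {γ : ℝ}
    (hγ : 0 < γ) {y : EuclideanSpace ℝ (Fin n)} (hy : psiG ψ γ y ≤ 0) (i : Fin r) : ψ i y ≤ 0 := by
  have hi : Real.exp (γ * ψ i y) ≤ ∑ j, Real.exp (γ * ψ j y) :=
    Finset.single_le_sum (f := fun j => Real.exp (γ * ψ j y)) (fun _ _ => (Real.exp_pos _).le)
      (Finset.mem_univ i)
  have hlog : Real.log (∑ j, Real.exp (γ * ψ j y)) ≤ 0 := by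
    rw [psiG, one_div_mul_eq_div] at hy
    simpa using (div_le_iff₀ hγ).1 hy
  have hle := ((Real.le_log_iff_exp_le ((Real.exp_pos _).trans_le hi)).2 hi).trans hlog
  exact nonpos_of_mul_nonpos_right hle hγ

theorem stmt_8 {n m r : ℕ} (hn : 0 < n) (hr : 0 < r)
    (ψ : Fin r → EuclideanSpace ℝ (Fin n) → ℝ)
    (ψ' : Fin r → EuclideanSpace ℝ (Fin n) → EuclideanSpace ℝ (Fin n))
    (C : Set (EuclideanSpace ℝ (Fin n)))
    (hCdef : C = ⋂ i, {x | ψ i x ≤ 0})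
    (hCne : C.Nonempty) (hCcp : IsCompact C)
    (hCconn : IsConnected (interior C))
    -- (A2.1)
    (ρ : ℝ) (hρ : 0 < ρ)
    (hdiff : ∀ i, ∀ x ∈ {y | ∃ c ∈ C, dist y c < ρ}, HasGradientAt (ψ i) (ψ' i x) x)
    (hlip : ∀ i, ∃ L : NNReal, LipschitzOnWith L (ψ' i) {y | ∃ c ∈ C, dist y c < ρ})
    -- (A2.2)
    (η : ℝ) (hη : 0 < η)
    (hA22 : ∀ c ∈ C, ∀ lam : Fin r → ℝ, (∀ i, 0 ≤ lam i) →
      (∀ i, ψ i c ≠ 0 → lam i = 0) → (∑ i, lam i) = 1 →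
      2 * η < ‖∑ i, lam i • ψ' i c‖)
    -- bound on the gradients
    (Mψ : ℝ) (hMψη : 2 * η ≤ Mψ) (hMψ : ∀ i, ∀ x ∈ C, ‖ψ' i x‖ ≤ Mψ)
    -- the control system
    (T : ℝ) (hT : 0 < T)
    (U : ℝ → Set (EuclideanSpace ℝ (Fin m)))
    (u : ℝ → EuclideanSpace ℝ (Fin m)) (hu : Measurable u)
    (huU : ∀ᵐ t ∂(volume.restrict (Icc (0:ℝ) T)), u t ∈ U t)
    (fΦ : ℝ → EuclideanSpace ℝ (Fin n) → EuclideanSpace ℝ (Fin m) → EuclideanSpace ℝ (Fin n))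
    (hfmeas : ∀ x ∈ C, ∀ v : EuclideanSpace ℝ (Fin m), Measurable fun t => fΦ t x v)
    (Mb : ℝ) (hMb : 0 < Mb)
    (hfreg : ∀ᵐ t ∂(volume.restrict (Icc (0:ℝ) T)),
      ContinuousOn (fun p : EuclideanSpace ℝ (Fin n) × EuclideanSpace ℝ (Fin m) =>
        fΦ t p.1 p.2) (C ×ˢ U t) ∧
      (∀ v ∈ U t, ∀ x ∈ C, ∀ y ∈ C, ‖fΦ t x v - fΦ t y v‖ ≤ Mb * ‖x - y‖) ∧
      (∀ x ∈ C, ∀ v ∈ U t, ‖fΦ t x v‖ ≤ Mb)) :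
    ∃ Γ : ℝ, 2 * Mb / η < Γ ∧ ∀ γ ≥ Γ,
      ∀ c : EuclideanSpace ℝ (Fin n), psiG ψ γ c ≤ -(alph η Mb γ) →
      ∀ x : ℝ → EuclideanSpace ℝ (Fin n),
        (∀ t ∈ Icc (0:ℝ) T, x t = c + ∫ s in (0:ℝ)..t,
          (fΦ s (x s) (u s) - ∑ i, (γ * Real.exp (γ * ψ i (x s))) • ψ' i (x s))) →
        -- (i)
        ((∀ t ∈ Icc (0:ℝ) T,
            x t ∈ {y : EuclideanSpace ℝ (Fin n) | psiG ψ γ y ≤ -(alph η Mb γ)}) ∧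
          {y : EuclideanSpace ℝ (Fin n) | psiG ψ γ y ≤ -(alph η Mb γ)} ⊆
            interior {y : EuclideanSpace ℝ (Fin n) | psiG ψ γ y ≤ 0} ∧
          interior {y : EuclideanSpace ℝ (Fin n) | psiG ψ γ y ≤ 0} ⊆ interior C) ∧
        -- (ii)
        (∀ t ∈ Icc (0:ℝ) T, ∀ i : Fin r,
          0 ≤ γ * Real.exp (γ * ψ i (x t)) ∧
          γ * Real.exp (γ * ψ i (x t)) ≤ ∑ j, γ * Real.exp (γ * ψ j (x t)) ∧
          (∑ j, γ * Real.exp (γ * ψ j (x t))) ≤ 2 * Mb / η) ∧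
        -- (iii)
        (∀ᵐ t ∂(volume.restrict (Icc (0:ℝ) T)),
          ‖fΦ t (x t) (u t) - ∑ i, (γ * Real.exp (γ * ψ i (x t))) • ψ' i (x t)‖
            ≤ Mb + 2 * Mb * Mψ / η) := by
  have hopen : IsOpen {y | ∃ c ∈ C, dist y c < ρ} := by
    have h : {y | ∃ c ∈ C, dist y c < ρ} = thickening ρ C := Set.ext fun y => mem_thickening_iff.symm
    exact h ▸ isOpen_thickening
  have hsub : C ⊆ {y | ∃ c ∈ C, dist y c < ρ} := fun c hc => ⟨c, hc, by rwa [dist_self]⟩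
  have hgrad : ∀ i, ∀ y ∈ C, HasGradientAt (ψ i) (ψ' i y) y := fun i y hy => hdiff i y (hsub hy)
  have hψcont : ∀ i, ∀ y ∈ C, ContinuousAt (ψ i) y := fun i y hy =>
    (hgrad i y hy).hasFDerivAt.continuousAt
  have hψ'cont : ∀ i, ∀ y ∈ C, ContinuousAt (ψ' i) y := fun i y hy =>
    let ⟨_, hL⟩ := hlip i
    hL.continuousOn.continuousAt (hopen.mem_nhds (hsub hy))
  have hCle : ∀ i, ∀ y ∈ C, ψ i y ≤ 0 := fun i y hy => by
    rw [hCdef] at hy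
    exact mem_iInter.1 hy i
  have hK : 0 < 2 * Mb / η := by positivity
  obtain ⟨Γ, hΓ⟩ := exists_forall_lt_norm_sum_exp_smul (η := η) hCcp
    (fun i y hy => (hψcont i y hy).continuousWithinAt)
    (fun i y hy => (hψ'cont i y hy).continuousWithinAt) hCle hK
    (fun c hc w h0 h1 h2 => by linarith [hA22 c hc w h0 h1 h2])
  refine ⟨max Γ (2 * Mb / η + 1), lt_max_of_lt_right (lt_add_one _), fun γ hγ c hc x hx => ?_⟩
  have hγK : 2 * Mb / η < γ := by linarith [le_max_right Γ (2 * Mb / η + 1)]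
  have hγ0 : 0 < γ := hK.trans hγK
  have hα : 0 < alph η Mb γ := by
    refine div_pos (Real.log_pos ?_) hγ0
    rw [one_lt_div (by positivity), mul_comm η]
    exact (div_lt_iff₀ hη).1 hγK
  have hzeroC : {y | psiG ψ γ y ≤ 0} ⊆ C := fun y hy => by
    rw [hCdef]
    exact mem_iInter.2 (nonpos_of_psiG_nonpos hγ0 hy)
  have hlevC : {y | psiG ψ γ y ≤ -(alph η Mb γ)} ⊆ C := fun y hy =>
    hzeroC (le_trans hy (neg_nonpos.2 hα.le))
  have hpsiG : ∀ y ∈ C, ContinuousAt (psiG ψ γ) y := fun y hy => by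
    have : Nonempty (Fin r) := ⟨⟨0, hr⟩⟩
    have hS : ContinuousAt (fun z => ∑ i, Real.exp (γ * ψ i z)) y :=
      (hasGradientAt_sum_exp γ fun i => hgrad i y hy).hasFDerivAt.continuousAt
    exact (hS.log (Finset.sum_pos (fun _ _ => Real.exp_pos _)
      Finset.univ_nonempty).ne').const_mul _
  have hlevInt : {y | psiG ψ γ y ≤ -(alph η Mb γ)} ⊆ interior {y | psiG ψ γ y ≤ 0} :=
    fun y hy => by
      have hlt : psiG ψ γ y < 0 := lt_of_le_of_lt hy (neg_lt_zero.2 hα)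
      exact mem_interior_iff_mem_nhds.2
        (((hpsiG y (hlevC hy)).eventually_lt_const hlt).mono fun _ h => h.le)
  have hint0 : interior {y | psiG ψ γ y ≤ 0} ⊆ interior C := interior_mono hzeroC
  have hclosed : IsClosed {y | psiG ψ γ y ≤ -(alph η Mb γ)} := by
    have h := ContinuousOn.preimage_isClosed_of_isClosed
      (fun y hy => (hpsiG y hy).continuousWithinAt) hCcp.isClosed
      (isClosed_Iic (a := -(alph η Mb γ)))
    rwa [inter_eq_right.2 (show psiG ψ γ ⁻¹' Iic (-(alph η Mb γ)) ⊆ C from hlevC)] at h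
  have hbound : ∀ᵐ t, t ∈ Icc (0 : ℝ) T → ∀ y ∈ C, ‖fΦ t y (u t)‖ ≤ Mb := by
    refine (ae_restrict_iff' measurableSet_Icc).1 ?_
    filter_upwards [huU, hfreg] with t h1 h2 y hy using h2.2.2 y hy _ h1
  have hinv : ∀ t ∈ Icc (0 : ℝ) T, x t ∈ {y | psiG ψ γ y ≤ -(alph η Mb γ)} := by
    intro t ht
    by_cases hii : IntervalIntegrable (fun s => fΦ s (x s) (u s) -
        ∑ i, (γ * Real.exp (γ * ψ i (x s))) • ψ' i (x s)) volume 0 t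
    swap
    · rw [hx t ht, intervalIntegral.integral_undef hii, add_zero]
      exact hc
    have hxc : ContinuousOn x (Icc 0 t) := by
      have h := continuousOn_const (c := c).add
        (intervalIntegral.continuousOn_primitive_interval' hii left_mem_uIcc)
      rw [uIcc_of_le ht.1] at h
      exact h.congr fun s hs => hx s ⟨hs.1, hs.2.trans ht.2⟩
    have hmain : Icc 0 t ⊆ x ⁻¹' {y | psiG ψ γ y ≤ -(alph η Mb γ)} := by
      refine IsClosed.Icc_subset_of_forall_exists_gt ?_ ?_ ?_
      · rw [inter_comm]
        exact hxc.preimage_isClosed_of_isClosed isClosed_Icc hclosed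
      · simpa [hx 0 ⟨le_rfl, hT.le⟩] using hc
      rintro a ⟨ha, ha0, hat⟩ z hz
      have haC := hlevC ha
      have hxa : ContinuousWithinAt x (Ioi a) a :=
        (hxc a ⟨ha0, hat.le⟩).mono_of_mem_nhdsWithin
          (mem_of_superset (Icc_mem_nhdsGT hat) (Icc_subset_Icc_left ha0))
      suffices h : ∀ᶠ s in nhdsWithin a (Ioi a), psiG ψ γ (x s) ≤ -(alph η Mb γ) from
        (h.and (Ioc_mem_nhdsGT hz)).exists
      have hS := hasGradientAt_sum_exp γ fun i => hgrad i _ haC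
      rcases lt_or_eq_of_le ((psiG_le_neg_alph_iff hr ψ hη hMb hγ0 _).1 ha) with hlt | hsum
      · rw [← Finset.mul_sum] at hlt
        have h := (((hS.hasFDerivAt.continuousAt.const_mul γ).tendsto.comp
          hxa).eventually_lt_const hlt)
        refine h.mono fun s hs => (psiG_le_neg_alph_iff hr ψ hη hMb hγ0 _).2 ?_
        rw [← Finset.mul_sum]
        exact hs.le
      have hnhds : ∀ᶠ s in nhdsWithin a (Ioi a), x s ∈ C :=
        hxa.eventually (mem_interior_iff_mem_nhds.1 (hint0 (hlevInt ha)))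
      obtain ⟨b', hab', hb'⟩ := mem_nhdsGT_iff_exists_Ioc_subset.1 hnhds
      have hab : a < min b' t := lt_min hab' hat
      have hbt : min b' t ≤ t := min_le_right _ _
      have hii' : ∀ {p q : ℝ}, 0 ≤ p → p ≤ q → q ≤ t → IntervalIntegrable (fun s =>
          fΦ s (x s) (u s) - ∑ i, (γ * Real.exp (γ * ψ i (x s))) • ψ' i (x s)) volume p q :=
        fun hp hpq hq => hii.mono_set (by
          rw [uIcc_of_le hpq, uIcc_of_le ht.1]; exact Icc_subset_Icc hp hq)
      have hdec := eventually_lt_of_integral_sub_gradient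
        (S := fun y => ∑ i, Real.exp (γ * ψ i y))
        (G := fun y => ∑ i, (γ * Real.exp (γ * ψ i y)) • ψ' i y)
        (x := x) (h := fun s => fΦ s (x s) (u s)) (M := Mb) hab hMb.le hS
        (tendsto_finsetSum _ fun i _ =>
          (((hψcont i _ haC).const_mul γ).rexp.const_mul γ).smul (hψ'cont i _ haC))
        hxa ?_ (hii' ha0 hab.le hbt) ?_ ?_
      · refine hdec.mono fun s hs => (psiG_le_neg_alph_iff hr ψ hη hMb hγ0 _).2 ?_
        rw [← hsum, ← Finset.mul_sum, ← Finset.mul_sum]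
        exact mul_le_mul_of_nonneg_left hs.le hγ0.le
      · have h := hΓ γ ((le_max_left _ _).trans hγ) _ haC hsum
        rw [mul_div_cancel₀ _ hη.ne'] at h
        linarith
      · intro s hs
        have hst := hs.2.trans hbt
        rw [hx s ⟨ha0.trans hs.1, hst.trans ht.2⟩, hx a ⟨ha0, hat.le.trans ht.2⟩,
          add_sub_add_left_eq_sub, intervalIntegral.integral_interval_sub_left
            (hii' le_rfl (ha0.trans hs.1) hst) (hii' le_rfl ha0 hat.le)]
      · filter_upwards [hbound] with s hs hsab
        exact hs ⟨ha0.trans hsab.1.le, (hsab.2.trans hbt).trans ht.2⟩ _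
          (hb' ⟨hsab.1, hsab.2.trans (min_le_left _ _)⟩)
    exact hmain ⟨ht.1, le_rfl⟩
  have hnn : ∀ y i, 0 ≤ γ * Real.exp (γ * ψ i y) := fun y i => by positivity
  have hsumle : ∀ t ∈ Icc (0 : ℝ) T, ∑ j, γ * Real.exp (γ * ψ j (x t)) ≤ 2 * Mb / η :=
    fun t ht => (psiG_le_neg_alph_iff hr ψ hη hMb hγ0 _).1 (hinv t ht)
  refine ⟨⟨hinv, hlevInt, hint0⟩, fun t ht i => ⟨hnn _ i, ?_, hsumle t ht⟩, ?_⟩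
  · exact Finset.single_le_sum (f := fun j => γ * Real.exp (γ * ψ j (x t)))
      (fun j _ => hnn _ j) (Finset.mem_univ i)
  · refine (ae_restrict_iff' measurableSet_Icc).2 ?_
    filter_upwards [hbound] with t hbt ht
    have htC := hlevC (hinv t ht)
    refine (norm_sub_le _ _).trans (add_le_add (hbt ht _ htC) ?_)
    calc ‖∑ i, (γ * Real.exp (γ * ψ i (x t))) • ψ' i (x t)‖
        ≤ ∑ i, γ * Real.exp (γ * ψ i (x t)) * Mψ := norm_sum_le_of_le _ fun i _ => by
          rw [norm_smul, Real.norm_of_nonneg (hnn _ i)]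
          exact mul_le_mul_of_nonneg_left (hMψ i _ htC) (hnn _ i)
      _ = (∑ i, γ * Real.exp (γ * ψ i (x t))) * Mψ := by rw [Finset.sum_mul]
      _ ≤ 2 * Mb / η * Mψ :=
          mul_le_mul_of_nonneg_right (hsumle t ht) (by linarith)
      _ = 2 * Mb * Mψ / η := by ring
end
end

section
/- Under (A2.1) and (A2.2), with C nonempty and compact: (a) C^γ ⊆ C for every γ > 0; (b) there exists Γ > 0 such that for all γ ≥ Γ the set C^γ is nonempty and compact; and (c) if r > 1, then C^γ is contained in the topological interior of C for every γ ≥ Γ. -/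
open Metric Set
open scoped BigOperators

noncomputable section

open Filter Topology

/-- The sublevel set of `psiG` at height `0` in terms of the sum of exponentials. -/
lemma psiG_nonpos_iff {n r : ℕ} (hr : 0 < r) (ψ : Fin r → EuclideanSpace ℝ (Fin n) → ℝ)
    {γ : ℝ} (hγ : 0 < γ) (x : EuclideanSpace ℝ (Fin n)) :
    psiG ψ γ x ≤ 0 ↔ ∑ i, Real.exp (γ * ψ i x) ≤ 1 := by
  have hpos : 0 < ∑ i, Real.exp (γ * ψ i x) :=
    Finset.sum_pos (fun i _ => Real.exp_pos _) ⟨⟨0, hr⟩, Finset.mem_univ _⟩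
  rw [psiG, mul_nonpos_iff_pos_imp_nonpos, ← Real.log_nonpos_iff hpos.le]
  exact ⟨fun h => h.1 (by positivity), fun h => ⟨fun _ => h, fun _ => (one_div_pos.2 hγ).le⟩⟩

/-- If no convex combination of the vectors `g i`, `i ∈ I`, vanishes, then some direction has
negative inner product with all of them. -/
lemma exists_inner_neg_of_convexCombination_ne_zero {ι E : Type*} [Fintype ι] [DecidableEq ι]
    [NormedAddCommGroup E] [InnerProductSpace ℝ E] [CompleteSpace E] (I : Set ι) (g : ι → E)
    (h : ∀ w : ι → ℝ, (∀ i, 0 ≤ w i) → (∀ i, i ∉ I → w i = 0) → ∑ i, w i = 1 →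
      ∑ i, w i • g i ≠ 0) :
    ∃ v : E, ∀ i ∈ I, inner ℝ (g i) v < 0 := by
  let K : Set (ι → ℝ) := stdSimplex ℝ ι ∩ {w | ∀ i, i ∉ I → w i = 0}
  have hKclosed : IsClosed {w : ι → ℝ | ∀ i, i ∉ I → w i = 0} := by
    simp only [Set.ofPred_forall]
    exact isClosed_iInter fun i => isClosed_iInter fun _ =>
      isClosed_eq (continuous_apply i) continuous_const
  have hKconvex : Convex ℝ K := by
    refine (convex_stdSimplex ℝ ι).inter ?_
    intro w hw z hz a b _ _ _ i hi
    simp [hw i hi, hz i hi]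
  have hKcompact : IsCompact K := (isCompact_stdSimplex ℝ ι).inter_right hKclosed
  let L : (ι → ℝ) →ₗ[ℝ] E := Fintype.linearCombination ℝ g
  have hL : ∀ w, L w = ∑ i, w i • g i := fun w => Fintype.linearCombination_apply ℝ g w
  have hLcont : Continuous L := L.continuous_of_finiteDimensional
  have h0 : (0 : E) ∉ L '' K := by
    rintro ⟨w, ⟨⟨hw0, hw1⟩, hwI⟩, hw⟩
    exact h w hw0 hwI hw1 (by rw [← hL, hw])
  obtain ⟨f, u, hu, hf⟩ := geometric_hahn_banach_point_closed (hKconvex.linear_image L)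
    (hKcompact.image hLcont).isClosed h0
  refine ⟨-(InnerProductSpace.toDual ℝ E).symm f, fun i hi => ?_⟩
  have hmem : g i ∈ L '' K := by
    refine ⟨Pi.single i 1, ⟨single_mem_stdSimplex ℝ i, fun j hj => ?_⟩, ?_⟩
    · exact Pi.single_eq_of_ne (by rintro rfl; exact hj hi) 1
    · simp [L]
  have hpos := hf _ hmem
  rw [map_zero] at hu
  rw [inner_neg_right, real_inner_comm, InnerProductSpace.toDual_symm_apply]
  linarith

/-- A function decreases initially along a direction having negative inner product with its
gradient. -/
lemma HasGradientAt.eventually_lt_of_inner_neg {E : Type*} [NormedAddCommGroup E]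
    [InnerProductSpace ℝ E] [CompleteSpace E] {f : E → ℝ} {g c v : E} (hf : HasGradientAt f g c)
    (hv : inner ℝ g v < 0) : ∀ᶠ t in 𝓝[>] (0 : ℝ), f (c + t • v) < f c := by
  have hline : HasDerivAt (fun t : ℝ => c + t • v) v 0 := by
    simpa using ((hasDerivAt_id (0 : ℝ)).smul_const v).const_add c
  have hcomp : HasDerivAt (fun t : ℝ => f (c + t • v)) (inner ℝ g v) 0 := by
    have hf' : HasFDerivAt f (InnerProductSpace.toDual ℝ E g) (c + (0 : ℝ) • v) := by
      simpa using hf.hasFDerivAt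
    simpa [Function.comp_def] using hf'.comp_hasDerivAt (0 : ℝ) hline
  filter_upwards [hcomp.tendsto_slope_zero_right.eventually_lt_const hv, self_mem_nhdsWithin]
    with t ht (htpos : 0 < t)
  simp only [zero_add, zero_smul, add_zero, smul_eq_mul] at ht
  have := (inv_mul_lt_iff₀ htpos).1 ht
  linarith

/-- A point at which all functions are nonpositive and no convex combination of the active
gradients vanishes yields a point at which all functions are negative. -/
lemma exists_forall_neg_of_active_convexCombination_ne_zero {ι E : Type*} [Fintype ι]
    [NormedAddCommGroup E] [InnerProductSpace ℝ E] [CompleteSpace E] {ψ : ι → E → ℝ} {g : ι → E}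
    {c : E} (hgrad : ∀ i, HasGradientAt (ψ i) (g i) c) (hc : ∀ i, ψ i c ≤ 0)
    (h : ∀ w : ι → ℝ, (∀ i, 0 ≤ w i) → (∀ i, ψ i c ≠ 0 → w i = 0) → ∑ i, w i = 1 →
      ∑ i, w i • g i ≠ 0) :
    ∃ x, ∀ i, ψ i x < 0 := by
  classical
  obtain ⟨v, hv⟩ := exists_inner_neg_of_convexCombination_ne_zero {i | ψ i c = 0} g h
  have hev : ∀ i, ∀ᶠ t in 𝓝[>] (0 : ℝ), ψ i (c + t • v) < 0 := by
    intro i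
    rcases (hc i).lt_or_eq with hi | hi
    · have hline : Tendsto (fun t : ℝ => c + t • v) (𝓝 0) (𝓝 c) := by
        have : Continuous fun t : ℝ => c + t • v := by fun_prop
        simpa using this.tendsto 0
      exact nhdsWithin_le_nhds
        (((hgrad i).continuousAt.tendsto.comp hline).eventually_lt_const hi)
    · simpa only [hi] using (hgrad i).eventually_lt_of_inner_neg (hv i hi)
  obtain ⟨t, ht⟩ := (eventually_all.2 hev).exists
  exact ⟨c + t • v, ht⟩

/-- For negative exponents, a sum of exponentials is at most `1` for all large parameters. -/
lemma exists_forall_ge_sum_exp_le_one {ι : Type*} [Fintype ι] {a : ι → ℝ} (ha : ∀ i, a i < 0) :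
    ∃ Γ > (0 : ℝ), ∀ γ ≥ Γ, ∑ i, Real.exp (γ * a i) ≤ 1 := by
  have hlim : Tendsto (fun γ : ℝ => ∑ i, Real.exp (γ * a i)) atTop (𝓝 0) := by
    rw [← Finset.sum_const_zero (ι := ι) (s := Finset.univ)]
    exact tendsto_finsetSum _ fun i _ =>
      Real.tendsto_exp_atBot.comp (tendsto_id.atTop_mul_const_of_neg (ha i))
  obtain ⟨N, hN⟩ := eventually_atTop.1 (hlim.eventually_le_const one_pos)
  exact ⟨max N 1, by positivity, fun γ hγ => hN γ ((le_max_left _ _).trans hγ)⟩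

theorem stmt_13 {n r : ℕ} (hn : 0 < n) (hr : 0 < r)
    (ψ : Fin r → EuclideanSpace ℝ (Fin n) → ℝ)
    (ψ' : Fin r → EuclideanSpace ℝ (Fin n) → EuclideanSpace ℝ (Fin n))
    (C : Set (EuclideanSpace ℝ (Fin n)))
    (hCdef : C = ⋂ i, {x | ψ i x ≤ 0})
    (hCne : C.Nonempty) (hCcp : IsCompact C)
    -- (A2.1)
    (ρ : ℝ) (hρ : 0 < ρ)
    (hdiff : ∀ i, ∀ x ∈ {y | ∃ c ∈ C, dist y c < ρ}, HasGradientAt (ψ i) (ψ' i x) x)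
    (hlip : ∀ i, ∃ L : NNReal, LipschitzOnWith L (ψ' i) {y | ∃ c ∈ C, dist y c < ρ})
    -- (A2.2)
    (η : ℝ) (hη : 0 < η)
    (hA22 : ∀ c ∈ C, ∀ lam : Fin r → ℝ, (∀ i, 0 ≤ lam i) →
      (∀ i, ψ i c ≠ 0 → lam i = 0) → (∑ i, lam i) = 1 →
      2 * η < ‖∑ i, lam i • ψ' i c‖) :
    -- (a)
    (∀ γ : ℝ, 0 < γ → {x : EuclideanSpace ℝ (Fin n) | psiG ψ γ x ≤ 0} ⊆ C) ∧
    -- (b) and (c)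
    (∃ Γ > (0:ℝ),
      (∀ γ ≥ Γ, {x : EuclideanSpace ℝ (Fin n) | psiG ψ γ x ≤ 0}.Nonempty ∧
        IsCompact {x : EuclideanSpace ℝ (Fin n) | psiG ψ γ x ≤ 0}) ∧
      (1 < r → ∀ γ ≥ Γ,
        {x : EuclideanSpace ℝ (Fin n) | psiG ψ γ x ≤ 0} ⊆ interior C)) := by
  have hmemC : ∀ x, x ∈ C ↔ ∀ i, ψ i x ≤ 0 := fun x => by simp [hCdef]
  have hgrad : ∀ x ∈ C, ∀ i, HasGradientAt (ψ i) (ψ' i x) x := fun x hx i =>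
    hdiff i x ⟨x, hx, by simpa using hρ⟩
  have hsub : ∀ γ : ℝ, 0 < γ → {x : EuclideanSpace ℝ (Fin n) | psiG ψ γ x ≤ 0} ⊆ C := by
    intro γ hγ x hx
    rw [mem_ofPred_eq, psiG_nonpos_iff hr ψ hγ] at hx
    refine (hmemC x).2 fun i => ?_
    have hi := (Finset.single_le_sum (f := fun i => Real.exp (γ * ψ i x))
      (fun j _ => (Real.exp_pos _).le) (Finset.mem_univ i)).trans hx
    exact nonpos_of_mul_nonpos_right (Real.exp_le_one_iff.1 hi) hγ
  obtain ⟨c, hc⟩ := hCne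
  obtain ⟨x₀, hx₀⟩ := exists_forall_neg_of_active_convexCombination_ne_zero (hgrad c hc)
    ((hmemC c).1 hc) fun w hw hwI hw1 => norm_pos_iff.1 <|
      (mul_pos two_pos hη).trans (hA22 c hc w hw hwI hw1)
  obtain ⟨Γ, hΓ, hΓsum⟩ := exists_forall_ge_sum_exp_le_one hx₀
  refine ⟨hsub, Γ, hΓ, fun γ hγ => ⟨⟨x₀, ?_⟩, ?_⟩, fun hr1 γ hγ x hx => ?_⟩
  · exact (psiG_nonpos_iff hr ψ (hΓ.trans_le hγ) x₀).2 (hΓsum γ hγ)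
  · have hγ0 : 0 < γ := hΓ.trans_le hγ
    have hcont : ContinuousOn (fun x => ∑ i, Real.exp (γ * ψ i x)) C := by
      refine continuousOn_finsetSum _ fun i _ => Real.continuous_exp.comp_continuousOn ?_
      exact continuousOn_const.mul fun x hx => (hgrad x hx i).continuousAt.continuousWithinAt
    have heq : {x : EuclideanSpace ℝ (Fin n) | psiG ψ γ x ≤ 0} =
        C ∩ (fun x => ∑ i, Real.exp (γ * ψ i x)) ⁻¹' Iic 1 := by
      ext x
      exact ⟨fun hx => ⟨hsub γ hγ0 hx, (psiG_nonpos_iff hr ψ hγ0 x).1 hx⟩,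
        fun hx => (psiG_nonpos_iff hr ψ hγ0 x).2 hx.2⟩
    rw [heq]
    exact hCcp.of_isClosed_subset (hcont.preimage_isClosed_of_isClosed hCcp.isClosed isClosed_Iic)
      inter_subset_left
  · have hγ0 : 0 < γ := hΓ.trans_le hγ
    have hxC := hsub γ hγ0 hx
    rw [mem_ofPred_eq, psiG_nonpos_iff hr ψ hγ0] at hx
    have : Nontrivial (Fin r) := Fin.nontrivial_iff_two_le.2 hr1
    have hneg : ∀ i, ψ i x < 0 := by
      intro i
      obtain ⟨j, hj⟩ := exists_ne i
      have hi := (Finset.single_lt_sum (f := fun i => Real.exp (γ * ψ i x)) hj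
        (Finset.mem_univ i) (Finset.mem_univ j) (Real.exp_pos _)
        (fun k _ _ => (Real.exp_pos _).le)).trans_le hx
      exact neg_of_mul_neg_right (Real.exp_lt_one_iff.1 hi) hγ0.le
    rw [mem_interior_iff_mem_nhds]
    filter_upwards [eventually_all.2 fun i =>
      (hgrad x hxC i).continuousAt.eventually_lt_const (hneg i)] with y hy
    exact (hmemC y).2 fun i => (hy i).le
end
end
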